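/- Let I be a topological space whose topology has finitely many open sets, let Y be a nonempty set, let D be the data sheaf on I with values in Y, let M be a presheaf of sets on I equipped with a metric d_U on M(U) for each open set U, and let Φ = (Φ_U) be a modeling map consisting of a function Φ_U : D(U) → M(U) for each open set U. If for every consistent assignment F = (f_U) of D and every open set U the local inconsistency Incon(F, U) = max over open V ⊆ U of d_V(res^M_{U,V}(Φ_U(f_U)), Φ_V(f_V)) equals 0, then Φ is a presheaf morphism, i.e. res^M_{U,V}(Φ_U(f_U)) = Φ_V(res^D_{U,V}(f_U)) for all open sets V ⊆ U and all f_U ∈ D(U). -/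

import Mathlib

open TopologicalSpace

/-- Restriction map of the data sheaf `D` on `I` with values in `Y`:
for open sets `V ≤ U`, a function `f : U → Y` restricts to a function `V → Y`. -/
def dataRes {I : Type*} [TopologicalSpace I] {Y : Type*} {U V : Opens I}
    (h : V ≤ U) (f : ↥U → Y) : ↥V → Y :=
  fun v => f ⟨v.1, h v.2⟩

/-- Every local section of the data sheaf on a nonempty set of values extends to a global one. -/
theorem exists_global_extension {I Y : Type*} [TopologicalSpace I] [Nonempty Y] {U : Opens I}
    (f : ↥U → Y) : ∃ g : I → Y, (fun x : ↥U => g x) = f :=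
  ⟨Function.extend Subtype.val f fun _ => Classical.arbitrary Y,
    Function.extend_comp Subtype.val_injective f _⟩

/-- If for every consistent assignment `F` of the data sheaf `D` and every
open set `U` the local inconsistency
`Incon(F, U) = max_{V ⊆ U} d_V(res^M_{U,V}(Φ_U(f_U)), Φ_V(f_V))` equals `0`, then the
modeling map `Φ` is a presheaf morphism:
`res^M_{U,V}(Φ_U(f_U)) = Φ_V(res^D_{U,V}(f_U))` for all open `V ⊆ U` and all `f_U ∈ D(U)`. -/
theorem presheafMorphism_of_inconsistency_zero
    {I Y : Type*} [TopologicalSpace I] [Finite (Opens I)] [Nonempty Y]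
    (M : Opens I → Type*) [∀ U, MetricSpace (M U)]
    (resM : ∀ {U V : Opens I}, V ≤ U → M U → M V)
    (resM_id : ∀ (U : Opens I) (m : M U), resM le_rfl m = m)
    (resM_comp : ∀ {U V W : Opens I} (hVU : V ≤ U) (hWV : W ≤ V) (m : M U),
      resM hWV (resM hVU m) = resM (hWV.trans hVU) m)
    (Φ : ∀ U : Opens I, (↥U → Y) → M U)
    (hincon : ∀ F : ∀ U : Opens I, ↥U → Y,
      (∀ (U V : Opens I) (h : V ≤ U), dataRes h (F U) = F V) →
      ∀ U : Opens I,
        (⨆ V : {V : Opens I // V ≤ U},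
          dist (resM V.2 (Φ U (F U))) (Φ V.1 (F V.1))) = 0) :
    ∀ (U V : Opens I) (h : V ≤ U) (f : ↥U → Y),
      resM h (Φ U f) = Φ V (dataRes h f) := by
  intro U V h f
  obtain ⟨g, rfl⟩ := exists_global_extension f
  have hsup := hincon (fun _ x => g x) (fun _ _ _ => rfl) U
  refine dist_le_zero.mp ?_
  rw [← hsup]
  exact le_ciSup (f := fun W : {W : Opens I // W ≤ U} =>
    dist (resM W.2 (Φ U fun x => g x)) (Φ W.1 fun x => g x))
    (Set.finite_range _).bddAbove ⟨V, h⟩
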